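/- For any P ∈ 𝔓̄_+ \ {0} and c ∈ ℭ_+, the functional J_P : 𝔓̄_+ \ {0} → ℝ is lower semicontinuous (with respect to the topology induced by the finite-dimensional coefficient space of trigonometric polynomials with frequencies in Λ). -/

import Mathlib

open MeasureTheory Complex Set

noncomputable section

namespace RCE

/-- The scalar product (k,θ) = Σⱼ kⱼ θⱼ. -/
def dotP (d : ℕ) (k : Fin d → ℤ) (θ : Fin d → ℝ) : ℝ := ∑ j, (k j : ℝ) * θ j

/-- The d-dimensional torus 𝕋^d = (−π,π]^d. -/
def Td (d : ℕ) : Set (Fin d → ℝ) := Set.univ.pi fun _ => Set.Ioc (-Real.pi) Real.pi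

/-- Normalized Lebesgue measure dm = (2π)^{-d} dθ on 𝕋^d. -/
def dm (d : ℕ) : Measure (Fin d → ℝ) :=
  (ENNReal.ofReal ((2 * Real.pi) ^ d))⁻¹ • (volume.restrict (Td d))

/-- Conjugate-symmetric coefficient sequences supported on Λ. -/
def IsCoeff (d : ℕ) (Λ : Finset (Fin d → ℤ)) (p : (Fin d → ℤ) → ℂ) : Prop :=
  (∀ k, k ∉ Λ → p k = 0) ∧ ∀ k, p (-k) = starRingEnd ℂ (p k)

/-- Evaluation of the (real-valued) trigonometric polynomial
`P(e^{iθ}) = Σ_{k∈Λ} p_k e^{-i(k,θ)}`. -/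
def eval (d : ℕ) (Λ : Finset (Fin d → ℤ)) (p : (Fin d → ℤ) → ℂ) (θ : Fin d → ℝ) : ℝ :=
  (∑ k ∈ Λ, p k * Complex.exp (-(dotP d k θ : ℂ) * Complex.I)).re

/-- `𝔓̄₊` : the closed cone of nonnegative trigonometric polynomials. -/
def Pbar (d : ℕ) (Λ : Finset (Fin d → ℤ)) : Set ((Fin d → ℤ) → ℂ) :=
  {p | IsCoeff d Λ p ∧ ∀ θ ∈ Td d, 0 ≤ eval d Λ p θ}

/-- `𝔓₊` : the open cone of positive trigonometric polynomials. -/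
def Pplus (d : ℕ) (Λ : Finset (Fin d → ℤ)) : Set ((Fin d → ℤ) → ℂ) :=
  {p | IsCoeff d Λ p ∧ ∀ θ ∈ Td d, 0 < eval d Λ p θ}

/-- The pairing ⟨c,p⟩ = Σ_{k∈Λ} c_k conj(p_k) (real-valued by conjugate symmetry). -/
def pair (d : ℕ) (Λ : Finset (Fin d → ℤ)) (c p : (Fin d → ℤ) → ℂ) : ℝ :=
  (∑ k ∈ Λ, c k * starRingEnd ℂ (p k)).re

/-- `ℭ₊` : the interior of the dual cone. -/
def Cplus (d : ℕ) (Λ : Finset (Fin d → ℤ)) : Set ((Fin d → ℤ) → ℂ) :=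
  {c | IsCoeff d Λ c ∧ ∀ p ∈ Pbar d Λ, p ≠ 0 → 0 < pair d Λ c p}

/-- `ℭ̄₊` : the closed dual cone. -/
def Cbar (d : ℕ) (Λ : Finset (Fin d → ℤ)) : Set ((Fin d → ℤ) → ℂ) :=
  {c | IsCoeff d Λ c ∧ ∀ p ∈ Pbar d Λ, 0 ≤ pair d Λ c p}

/-- The dual functional J_P(Q) = ⟨c,q⟩ − ∫ P log Q dm. -/
def J (d : ℕ) (Λ : Finset (Fin d → ℤ)) (c P Q : (Fin d → ℤ) → ℂ) : ℝ :=
  pair d Λ c Q - ∫ θ, eval d Λ P θ * Real.log (eval d Λ Q θ) ∂(dm d)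

/-- Covariance matching for an absolutely continuous measure Φ dm:
`c_k = ∫ e^{i(k,θ)} Φ(θ) dm(θ)` for all k ∈ Λ. -/
def Matches (d : ℕ) (Λ : Finset (Fin d → ℤ)) (c : (Fin d → ℤ) → ℂ)
    (Φ : (Fin d → ℝ) → ℝ) : Prop :=
  ∀ k ∈ Λ, c k = ∫ θ, Complex.exp ((dotP d k θ : ℂ) * Complex.I) * (Φ θ : ℂ) ∂(dm d)

open Filter Topology Polynomial

lemma measurableSet_Td (d : ℕ) : MeasurableSet (Td d) :=
  MeasurableSet.univ_pi fun _ => measurableSet_Ioc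

lemma volume_Td_lt_top (d : ℕ) : volume (Td d) < ⊤ := by
  rw [Td, Real.volume_pi_Ioc]
  exact ENNReal.prod_lt_top fun _ _ => ENNReal.ofReal_lt_top

instance isFiniteMeasure_restrict_Td (d : ℕ) : IsFiniteMeasure (volume.restrict (Td d)) :=
  isFiniteMeasure_restrict.mpr (volume_Td_lt_top d).ne

/-- Translation invariance over one period cell. -/
lemma setLIntegral_Td_add {d : ℕ} {f : (Fin d → ℝ) → ENNReal} (hf : Measurable f)
    (hper : ∀ (m : Fin d → ℤ) θ, f (fun j => θ j + m j * (2 * Real.pi)) = f θ)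
    (a : Fin d → ℝ) :
    ∫⁻ θ in Td d, f (θ + a) = ∫⁻ θ in Td d, f θ := by
  have : Fact (0 < 2 * Real.pi) := ⟨Real.two_pi_pos⟩
  let e := AddCircle.measurableEquivIoc (2 * Real.pi) (-Real.pi)
  let mk : (Fin d → ℝ) → (Fin d → AddCircle (2 * Real.pi)) := fun θ j => (θ j : AddCircle _)
  let G : (Fin d → AddCircle (2 * Real.pi)) → ENNReal := fun x => f fun j => (e (x j) : ℝ)
  have hG : Measurable G := by
    refine hf.comp (measurable_pi_lambda _ fun j => ?_)
    exact measurable_subtype_coe.comp (e.measurable.comp (measurable_pi_apply j))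
  have hfG : ∀ θ, f θ = G (mk θ) := by
    intro θ
    have h1 : ∀ j, ∃ n : ℤ, (e (mk θ j) : ℝ) = θ j + n * (2 * Real.pi) := by
      intro j
      have h : (((e (mk θ j) : ℝ)) : AddCircle (2 * Real.pi)) = (θ j : AddCircle _) :=
        (AddCircle.equivIoc (2 * Real.pi) (-Real.pi)).symm_apply_apply (mk θ j)
      rw [← sub_eq_zero, ← AddCircle.coe_sub, AddCircle.coe_eq_zero_iff] at h
      obtain ⟨n, hn⟩ := h
      exact ⟨n, by rw [zsmul_eq_mul] at hn; linarith⟩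
    choose n hn using h1
    simp only [G, hn, hper]
  have hmp : MeasurePreserving mk (volume.restrict (Td d)) volume := by
    have h := measurePreserving_pi (fun _ : Fin d => volume.restrict
      (Ioc (-Real.pi) (-Real.pi + 2 * Real.pi)))
      (fun _ : Fin d => (volume : Measure (AddCircle (2 * Real.pi))))
      (fun _ => AddCircle.measurePreserving_mk (2 * Real.pi) (-Real.pi))
    rw [← Measure.restrict_pi_pi] at h
    have hI : -Real.pi + 2 * Real.pi = Real.pi := by ring
    rw [hI] at h
    exact h
  calc ∫⁻ θ in Td d, f (θ + a) = ∫⁻ θ in Td d, G (mk θ + mk a) := by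
        simp only [hfG]; rfl
    _ = ∫⁻ x, G (x + mk a) := hmp.lintegral_comp (hG.comp (measurable_add_const _))
    _ = ∫⁻ x, G x := lintegral_add_right_eq_self _ _
    _ = ∫⁻ θ in Td d, G (mk θ) := (hmp.lintegral_comp hG).symm
    _ = ∫⁻ θ in Td d, f θ := by simp only [hfG]

/-- The function `C - log y`, with the value `∞` at `y = 0`. -/
def logDefect (C y : ℝ) : ENNReal := if y = 0 then ⊤ else ENNReal.ofReal (C - Real.log y)

lemma measurable_logDefect (C : ℝ) : Measurable (logDefect C) :=
  Measurable.ite (measurableSet_singleton 0) measurable_const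
    (ENNReal.measurable_ofReal.comp (measurable_const.sub Real.measurable_log))

/-- Jensen's bound for a polynomial on the unit circle. -/
lemma setLIntegral_logDefect_polynomial_le {p : ℂ[X]} (hp : p ≠ 0) {C δ : ℝ} (hδ : 0 < δ)
    (hlead : δ ≤ ‖p.leadingCoeff‖)
    (hC : ∀ t, Real.log ‖p.eval (circleMap 0 1 t)‖ ≤ C) :
    ∫⁻ t in Ioc 0 (2 * Real.pi), logDefect C ‖p.eval (circleMap 0 1 t)‖ ≤
      ENNReal.ofReal (2 * Real.pi * (C - Real.log δ)) := by
  have hne : ∀ᵐ t ∂(volume.restrict (Ioc 0 (2 * Real.pi))),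
      ‖p.eval (circleMap 0 1 t)‖ ≠ 0 := by
    rw [ae_restrict_iff' measurableSet_Ioc]
    have hfin : (Ioc 0 (2 * Real.pi) ∩ circleMap 0 1 ⁻¹' {z | p.IsRoot z}).Finite := by
      refine Set.Finite.of_finite_image (f := circleMap 0 1) ?_ ?_
      · refine (Polynomial.finite_setOfPred_isRoot hp).subset ?_
        rintro _ ⟨t, ht, rfl⟩
        exact ht.2
      · have h := injOn_circleMap_of_abs_sub_le (c := 0) (a := 0) (b := 2 * Real.pi) one_ne_zero
          (by rw [zero_sub, abs_neg, abs_of_pos Real.two_pi_pos])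
        rw [uIoc_of_le Real.two_pi_pos.le] at h
        exact h.mono inter_subset_left
    filter_upwards [hfin.countable.ae_notMem volume] with t ht htI h0
    exact ht ⟨htI, norm_eq_zero.mp h0⟩
  have hint : IntervalIntegrable (fun t => Real.log ‖p.eval (circleMap 0 1 t)‖) volume
      0 (2 * Real.pi) := p.intervalIntegrable_mahlerMeasure
  have hint' := (intervalIntegrable_iff_integrableOn_Ioc_of_le Real.two_pi_pos.le).mp
    ((intervalIntegrable_const (c := C)).sub hint)
  calc _ = ∫⁻ t in Ioc 0 (2 * Real.pi),
        ENNReal.ofReal (C - Real.log ‖p.eval (circleMap 0 1 t)‖) := by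
        refine lintegral_congr_ae ?_
        filter_upwards [hne] with t ht
        simp only [logDefect, if_neg ht]
    _ = ENNReal.ofReal (∫ t in Ioc 0 (2 * Real.pi),
        (C - Real.log ‖p.eval (circleMap 0 1 t)‖)) := by
        rw [ofReal_integral_eq_lintegral_ofReal hint']
        exact Eventually.of_forall fun t => sub_nonneg.mpr (hC t)
    _ ≤ _ := by
        refine ENNReal.ofReal_le_ofReal ?_
        have h1 : Real.log δ ≤ p.logMahlerMeasure := by
          rw [logMahlerMeasure_eq_log_MahlerMeasure]
          exact Real.log_le_log hδ (hlead.trans p.leadingCoeff_le_mahlerMeasure)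
        rw [logMahlerMeasure_def, Real.circleAverage_def, smul_eq_mul,
          inv_mul_eq_div, le_div_iff₀ Real.two_pi_pos] at h1
        rw [← intervalIntegral.integral_of_le Real.two_pi_pos.le,
          intervalIntegral.integral_sub intervalIntegrable_const hint,
          intervalIntegral.integral_const, smul_eq_mul]
        nlinarith
/-- Some integer direction separates any finite set of frequencies. -/
lemma exists_injOn_sum_mul {d : ℕ} (Λ : Finset (Fin d → ℤ)) :
    ∃ v : Fin d → ℤ, InjOn (fun k : Fin d → ℤ => ∑ j, k j * v j) (Λ : Set (Fin d → ℤ)) := by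
  let W : (Fin d → ℤ) → ℤ[X] := fun k => ∑ j : Fin d, C (k j) * X ^ (j : ℕ)
  have hW : Function.Injective W := by
    intro k l h
    funext i
    have h' := congrArg (fun q : ℤ[X] => q.coeff i) h
    simpa [W, coeff_C_mul, coeff_X_pow, Fin.val_inj] using h'
  have hprod : ∏ q ∈ Λ.offDiag, (W q.1 - W q.2) ≠ 0 := by
    refine Finset.prod_ne_zero_iff.mpr fun q hq => sub_ne_zero.mpr fun h => ?_
    exact (Finset.mem_offDiag.mp hq).2.2 (hW h)
  obtain ⟨N, hN⟩ : ∃ N : ℤ, (∏ q ∈ Λ.offDiag, (W q.1 - W q.2)).eval N ≠ 0 := by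
    by_contra! h
    exact hprod (Polynomial.funext fun r => by rw [h r, eval_zero])
  refine ⟨fun j => N ^ (j : ℕ), fun k hk l hl h => ?_⟩
  by_contra hkl
  rw [eval_prod] at hN
  refine Finset.prod_ne_zero_iff.mp hN (k, l) (Finset.mem_offDiag.mpr ⟨hk, hl, hkl⟩) ?_
  simpa [W, eval_finsetSum, sub_eq_zero] using h

/-- The complex-valued trigonometric sum whose real part is `eval`. -/
def trigSum (d : ℕ) (Λ : Finset (Fin d → ℤ)) (p : (Fin d → ℤ) → ℂ) (θ : Fin d → ℝ) : ℂ :=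
  ∑ k ∈ Λ, p k * Complex.exp (-(dotP d k θ : ℂ) * Complex.I)

lemma continuous_dotP (d : ℕ) (k : Fin d → ℤ) : Continuous (dotP d k) := by
  unfold dotP; fun_prop

lemma continuous_trigSum (d : ℕ) (Λ : Finset (Fin d → ℤ)) (p : (Fin d → ℤ) → ℂ) :
    Continuous (trigSum d Λ p) := by
  have := continuous_dotP d
  unfold trigSum; fun_prop

lemma norm_exp_neg_ofReal_mul_I (x : ℝ) : ‖Complex.exp (-(x : ℂ) * Complex.I)‖ = 1 := by
  rw [← Complex.ofReal_neg, Complex.norm_exp_ofReal_mul_I]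

lemma norm_trigSum_le (d : ℕ) (Λ : Finset (Fin d → ℤ)) (p : (Fin d → ℤ) → ℂ) (θ : Fin d → ℝ) :
    ‖trigSum d Λ p θ‖ ≤ ∑ k ∈ Λ, ‖p k‖ := by
  refine norm_sum_le_of_le _ fun k _ => ?_
  rw [norm_mul, norm_exp_neg_ofReal_mul_I, mul_one]

lemma trigSum_add_period {d : ℕ} (Λ : Finset (Fin d → ℤ)) (p : (Fin d → ℤ) → ℂ)
    (m : Fin d → ℤ) (θ : Fin d → ℝ) :
    trigSum d Λ p (fun j => θ j + m j * (2 * Real.pi)) = trigSum d Λ p θ := by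
  refine Finset.sum_congr rfl fun k _ => ?_
  congr 1
  refine Complex.exp_eq_exp_iff_exists_int.mpr ⟨-∑ j, k j * m j, ?_⟩
  have h : dotP d k (fun j => θ j + m j * (2 * Real.pi)) =
      dotP d k θ + (∑ j, k j * m j : ℤ) * (2 * Real.pi) := by
    simp only [dotP, mul_add, Finset.sum_add_distrib]
    push_cast
    rw [Finset.sum_mul]
    congr 1
    exact Finset.sum_congr rfl fun j _ => by ring
  rw [h]
  push_cast
  ring

/-- Along a separating direction a trigonometric sum is, up to a unimodular factor, a polynomial
on the unit circle whose nonzero coefficients have the moduli of those of `p`. -/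
lemma exists_polynomial_trigSum {d : ℕ} {Λ : Finset (Fin d → ℤ)} {v : Fin d → ℤ}
    (hv : InjOn (fun k : Fin d → ℤ => ∑ j, k j * v j) (Λ : Set (Fin d → ℤ)))
    {p : (Fin d → ℤ) → ℂ} (hp : ∃ k ∈ Λ, p k ≠ 0) (θ : Fin d → ℝ) :
    ∃ q : ℂ[X], q ≠ 0 ∧ (∃ k ∈ Λ, p k ≠ 0 ∧ ‖q.leadingCoeff‖ = ‖p k‖) ∧
      ∀ t : ℝ, ‖q.eval (circleMap 0 1 t)‖ = ‖trigSum d Λ p (θ + fun j => t * v j)‖ := by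
  let m : (Fin d → ℤ) → ℤ := fun k => ∑ j, k j * v j
  let M : ℤ := ∑ k ∈ Λ, |m k|
  let n : (Fin d → ℤ) → ℕ := fun k => (M - m k).toNat
  have hn : ∀ k ∈ Λ, (n k : ℤ) = M - m k := fun k hk =>
    Int.toNat_of_nonneg (sub_nonneg.mpr ((le_abs_self _).trans
      (Finset.single_le_sum (f := fun k => |m k|) (fun _ _ => abs_nonneg _) hk)))
  have hninj : ∀ k ∈ Λ, ∀ l ∈ Λ, n k = n l → k = l := by
    intro k hk l hl h
    have h1 := hn k hk
    have h2 := hn l hl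
    rw [h] at h1
    exact hv hk hl (show m k = m l by linarith)
  let a : (Fin d → ℤ) → ℂ := fun k => p k * Complex.exp (-(dotP d k θ : ℂ) * Complex.I)
  have ha : ∀ k, ‖a k‖ = ‖p k‖ := fun k => by
    simp only [a, norm_mul, norm_exp_neg_ofReal_mul_I, mul_one]
  let q : ℂ[X] := ∑ k ∈ Λ, monomial (n k) (a k)
  have hcoeff : ∀ k ∈ Λ, q.coeff (n k) = a k := by
    intro k hk
    simp only [q, finsetSum_coeff, coeff_monomial]
    rw [Finset.sum_eq_single_of_mem k hk fun l hl hlk => if_neg fun h => hlk (hninj l hl k hk h),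
      if_pos rfl]
  have hq : q ≠ 0 := by
    obtain ⟨k, hk, hpk⟩ := hp
    intro h
    have h1 := hcoeff k hk
    rw [h, coeff_zero] at h1
    exact hpk (norm_eq_zero.mp (by rw [← ha k, ← h1, norm_zero]))
  refine ⟨q, hq, ?_, fun t => ?_⟩
  · have hl : q.coeff q.natDegree ≠ 0 := leadingCoeff_ne_zero.mpr hq
    have hl' := hl
    simp only [q, finsetSum_coeff] at hl'
    obtain ⟨k, hk, hk0⟩ := Finset.exists_ne_zero_of_sum_ne_zero hl'
    have hnk : n k = q.natDegree := by
      by_contra h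
      exact hk0 (by rw [coeff_monomial]; exact if_neg h)
    have hlead : q.leadingCoeff = a k := by rw [leadingCoeff, ← hnk, hcoeff k hk]
    refine ⟨k, hk, fun h => leadingCoeff_ne_zero.mpr hq ?_, by rw [hlead, ha]⟩
    rw [hlead]
    simp [a, h]
  · have key : q.eval (circleMap 0 1 t) =
        Complex.exp ((M * t : ℝ) * Complex.I) * trigSum d Λ p (θ + fun j => t * v j) := by
      simp only [q, eval_finsetSum, eval_monomial, trigSum, Finset.mul_sum, a]
      refine Finset.sum_congr rfl fun k hk => ?_
      have hdot : dotP d k (θ + fun j => t * v j) = dotP d k θ + t * m k := by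
        simp only [dotP, Pi.add_apply, mul_add, Finset.sum_add_distrib, m]
        push_cast
        rw [Finset.mul_sum]
        congr 1
        exact Finset.sum_congr rfl fun j _ => by ring
      have hnc : (n k : ℂ) = M - m k := by exact_mod_cast congrArg (Int.cast : ℤ → ℂ) (hn k hk)
      rw [circleMap_zero, Complex.ofReal_one, one_mul, ← Complex.exp_nat_mul, mul_assoc (p k),
        ← Complex.exp_add, mul_left_comm _ (p k), ← Complex.exp_add, hdot, hnc]
      congr 2
      push_cast
      ring
    rw [key, norm_mul, Complex.norm_exp_ofReal_mul_I, one_mul]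

lemma setLIntegral_logDefect_trigSum_lt_top {d : ℕ} {Λ : Finset (Fin d → ℤ)}
    {p : (Fin d → ℤ) → ℂ} (hp : ∃ k ∈ Λ, p k ≠ 0) :
    ∫⁻ θ in Td d, logDefect (∑ k ∈ Λ, ‖p k‖) ‖trigSum d Λ p θ‖ < ⊤ := by
  set S := ∑ k ∈ Λ, ‖p k‖ with hS
  obtain ⟨v, hv⟩ := exists_injOn_sum_mul Λ
  obtain ⟨δ, hδ, hδp⟩ : ∃ δ > 0, ∀ k ∈ Λ, p k ≠ 0 → δ ≤ ‖p k‖ := by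
    obtain ⟨k, hk, hmin⟩ := (Λ.filter fun k => p k ≠ 0).exists_min_image (fun k => ‖p k‖)
      (by obtain ⟨k, hk, h⟩ := hp; exact ⟨k, Finset.mem_filter.mpr ⟨hk, h⟩⟩)
    exact ⟨‖p k‖, norm_pos_iff.mpr (Finset.mem_filter.mp hk).2, fun l hl h =>
      hmin l (Finset.mem_filter.mpr ⟨hl, h⟩)⟩
  let f : (Fin d → ℝ) → ENNReal := fun θ => logDefect S ‖trigSum d Λ p θ‖
  have hf : Measurable f :=
    (measurable_logDefect S).comp (continuous_trigSum d Λ p).norm.measurable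
  have hinner : ∀ θ, ∫⁻ t in Ioc 0 (2 * Real.pi), f (θ + fun j => t * v j) ≤
      ENNReal.ofReal (2 * Real.pi * (S - Real.log δ)) := by
    intro θ
    obtain ⟨q, hq, ⟨k, hk, hpk, hlead⟩, heval⟩ := exists_polynomial_trigSum hv hp θ
    simp only [f, ← heval]
    refine setLIntegral_logDefect_polynomial_le hq hδ (hlead ▸ hδp k hk hpk) fun t => ?_
    rw [heval]
    exact (Real.log_le_self (norm_nonneg _)).trans (norm_trigSum_le d Λ p _)
  have hswap : ∫⁻ t in Ioc 0 (2 * Real.pi), (∫⁻ θ in Td d, f θ) =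
      ∫⁻ θ in Td d, ∫⁻ t in Ioc 0 (2 * Real.pi), f (θ + fun j => t * v j) := by
    symm
    rw [lintegral_lintegral_swap]
    · refine lintegral_congr fun t => setLIntegral_Td_add hf (fun m θ => ?_) _
      simp only [f, trigSum_add_period]
    · have hg : Measurable fun z : (Fin d → ℝ) × ℝ => z.1 + fun j => z.2 * (v j : ℝ) := by
        fun_prop
      exact (hf.comp hg).aemeasurable
  have hle : (∫⁻ θ in Td d, f θ) * ENNReal.ofReal (2 * Real.pi) < ⊤ := by
    calc _ = ∫⁻ t in Ioc 0 (2 * Real.pi), (∫⁻ θ in Td d, f θ) := by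
          rw [setLIntegral_const, Real.volume_Ioc, sub_zero]
      _ ≤ ∫⁻ _ in Td d, ENNReal.ofReal (2 * Real.pi * (S - Real.log δ)) :=
          hswap.trans_le (lintegral_mono hinner)
      _ < ⊤ := by
          rw [setLIntegral_const]
          exact ENNReal.mul_lt_top ENNReal.ofReal_lt_top (volume_Td_lt_top d)
  by_contra h
  rw [not_lt, top_le_iff] at h
  rw [show ∫⁻ θ in Td d, f θ = ⊤ from h, ENNReal.top_mul] at hle
  · exact hle.ne rfl
  · exact (ENNReal.ofReal_pos.mpr Real.two_pi_pos).ne'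

lemma trigSum_eq_ofReal_eval {d : ℕ} {Λ : Finset (Fin d → ℤ)} (hΛ : ∀ k ∈ Λ, -k ∈ Λ)
    {p : (Fin d → ℤ) → ℂ} (hp : IsCoeff d Λ p) (θ : Fin d → ℝ) :
    trigSum d Λ p θ = (eval d Λ p θ : ℂ) := by
  have hconj : starRingEnd ℂ (trigSum d Λ p θ) = trigSum d Λ p θ := by
    simp only [trigSum, map_sum]
    refine Finset.sum_nbij' (fun k => -k) (fun k => -k) hΛ hΛ (fun _ _ => neg_neg _)
      (fun _ _ => neg_neg _) fun k _ => ?_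
    have hdot : dotP d (-k) θ = -dotP d k θ := by simp [dotP]
    rw [map_mul, ← hp.2, ← Complex.exp_conj, hdot]
    simp
  exact (Complex.conj_eq_iff_re.mp hconj).symm

lemma abs_eval_le (d : ℕ) (Λ : Finset (Fin d → ℤ)) (p : (Fin d → ℤ) → ℂ) (θ : Fin d → ℝ) :
    |eval d Λ p θ| ≤ ∑ k ∈ Λ, ‖p k‖ :=
  (Complex.abs_re_le_norm _).trans (norm_trigSum_le d Λ p θ)

lemma continuous_eval (d : ℕ) (Λ : Finset (Fin d → ℤ)) (p : (Fin d → ℤ) → ℂ) :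
    Continuous (eval d Λ p) :=
  Complex.continuous_re.comp (continuous_trigSum d Λ p)

lemma ae_dm_of_ae_restrict {d : ℕ} {s : (Fin d → ℝ) → Prop}
    (h : ∀ᵐ θ ∂(volume.restrict (Td d)), s θ) : ∀ᵐ θ ∂(dm d), s θ :=
  Measure.ae_smul_measure h _

lemma inv_ofReal_two_pi_pow_ne_top (d : ℕ) :
    (ENNReal.ofReal ((2 * Real.pi) ^ d))⁻¹ ≠ ⊤ :=
  ENNReal.inv_ne_top.mpr (ENNReal.ofReal_pos.mpr (pow_pos Real.two_pi_pos d)).ne'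

instance isFiniteMeasure_dm (d : ℕ) : IsFiniteMeasure (dm d) :=
  Measure.smul_finite _ (inv_ofReal_two_pi_pow_ne_top d)

/-- A nonzero real trigonometric polynomial is almost everywhere nonzero, with integrable
logarithm. -/
lemma ae_eval_ne_zero_and_integrable_log {d : ℕ} {Λ : Finset (Fin d → ℤ)}
    (hΛ : ∀ k ∈ Λ, -k ∈ Λ) {p : (Fin d → ℤ) → ℂ} (hp : IsCoeff d Λ p) (hp0 : p ≠ 0) :
    (∀ᵐ θ ∂(dm d), eval d Λ p θ ≠ 0) ∧
      Integrable (fun θ => Real.log (eval d Λ p θ)) (dm d) := by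
  have hex : ∃ k ∈ Λ, p k ≠ 0 := by
    obtain ⟨k, hk⟩ := Function.ne_iff.mp hp0
    exact ⟨k, by_contra fun h => hk (hp.1 k h), hk⟩
  have hlt := setLIntegral_logDefect_trigSum_lt_top hex
  set S := ∑ k ∈ Λ, ‖p k‖
  have hnorm : ∀ θ, ‖trigSum d Λ p θ‖ = |eval d Λ p θ| := fun θ => by
    rw [trigSum_eq_ofReal_eval hΛ hp, Complex.norm_real, Real.norm_eq_abs]
  simp only [hnorm] at hlt
  have hmeas : Measurable fun θ => logDefect S |eval d Λ p θ| :=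
    (measurable_logDefect S).comp (continuous_eval d Λ p).abs.measurable
  refine ⟨ae_dm_of_ae_restrict ?_, ?_⟩
  · filter_upwards [ae_lt_top hmeas hlt.ne] with θ hθ h0
    simp [logDefect, h0] at hθ
  · refine Integrable.smul_measure ?_ (inv_ofReal_two_pi_pow_ne_top d)
    have hint : Integrable (fun θ => S - Real.log (eval d Λ p θ)) (volume.restrict (Td d)) := by
      refine ⟨(measurable_const.sub (Real.measurable_log.comp
        (continuous_eval d Λ p).measurable)).aestronglyMeasurable, lt_of_le_of_lt ?_ hlt⟩
      refine lintegral_mono fun θ => ?_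
      have hnn : 0 ≤ S - Real.log (eval d Λ p θ) := by
        rw [← Real.log_abs]
        exact sub_nonneg.mpr ((Real.log_le_self (abs_nonneg _)).trans (abs_eval_le d Λ p θ))
      rw [Real.enorm_of_nonneg hnn, logDefect]
      split_ifs
      · exact le_top
      · rw [Real.log_abs]
    exact ((integrable_const S).sub hint).congr (Eventually.of_forall fun θ => sub_sub_cancel _ _)

lemma ae_dm_mem_Td (d : ℕ) : ∀ᵐ θ ∂(dm d), θ ∈ Td d :=
  ae_dm_of_ae_restrict (ae_restrict_mem (measurableSet_Td d))

lemma continuous_eval_coeff (d : ℕ) (Λ : Finset (Fin d → ℤ)) (θ : Fin d → ℝ) :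
    Continuous fun p => eval d Λ p θ := by
  unfold eval; fun_prop

lemma continuous_pair (d : ℕ) (Λ : Finset (Fin d → ℤ)) (c : (Fin d → ℤ) → ℂ) :
    Continuous (pair d Λ c) := by
  unfold pair
  exact Complex.continuous_re.comp (continuous_finsetSum _ fun k _ =>
    continuous_const.mul (Complex.continuous_conj.comp (continuous_apply k)))

lemma abs_log_le_of_mem_Icc {a b y : ℝ} (ha : 0 < a) (hy : y ∈ Icc a b) :
    |Real.log y| ≤ |Real.log a| + |Real.log b| :=
  (abs_le_max_abs_abs (Real.log_le_log ha hy.1)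
    (Real.log_le_log (ha.trans_le hy.1) hy.2)).trans
    (max_le_add_of_nonneg (abs_nonneg _) (abs_nonneg _))

lemma integrable_eval_mul {d : ℕ} (Λ : Finset (Fin d → ℤ)) (P : (Fin d → ℤ) → ℂ)
    {g : (Fin d → ℝ) → ℝ} (hg : Integrable g (dm d)) :
    Integrable (fun θ => eval d Λ P θ * g θ) (dm d) :=
  hg.bdd_mul (continuous_eval d Λ P).aestronglyMeasurable
    (Eventually.of_forall fun θ => abs_eval_le d Λ P θ)

lemma measurable_eval_mul_log {d : ℕ} (Λ : Finset (Fin d → ℤ)) (P Q : (Fin d → ℤ) → ℂ) (ε : ℝ) :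
    Measurable fun θ => eval d Λ P θ * Real.log (eval d Λ Q θ + ε) :=
  (continuous_eval d Λ P).measurable.mul
    (Real.measurable_log.comp ((continuous_eval d Λ Q).measurable.add_const ε))

/-- The regularized entropy integral is continuous in the coefficients. -/
lemma continuousWithinAt_integral_log_add {d : ℕ} {Λ : Finset (Fin d → ℤ)}
    (P Q₀ : (Fin d → ℤ) → ℂ) (hQ₀ : Q₀ ∈ Pbar d Λ) {ε : ℝ} (hε : 0 < ε) :
    ContinuousWithinAt
      (fun Q => ∫ θ, eval d Λ P θ * Real.log (eval d Λ Q θ + ε) ∂(dm d)) (Pbar d Λ) Q₀ := by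
  let S : ((Fin d → ℤ) → ℂ) → ℝ := fun Q => ∑ k ∈ Λ, ‖Q k‖
  have hS : Continuous S := by fun_prop
  refine continuousWithinAt_of_dominated
    (bound := fun _ => S P * (|Real.log ε| + |Real.log (S Q₀ + 1 + ε)|))
    (Eventually.of_forall fun Q => (measurable_eval_mul_log Λ P Q ε).aestronglyMeasurable)
    ?_ (integrable_const _) ?_
  · have hev : ∀ᶠ Q in 𝓝[Pbar d Λ] Q₀, S Q < S Q₀ + 1 :=
      (hS.continuousAt.eventually_lt continuousAt_const (lt_add_one _)).filter_mono
        nhdsWithin_le_nhds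
    filter_upwards [hev, self_mem_nhdsWithin] with Q hQS hQ
    filter_upwards [ae_dm_mem_Td d] with θ hθ
    rw [norm_mul]
    have h0 := hQ.2 θ hθ
    have h1 := (le_abs_self _).trans (abs_eval_le d Λ Q θ)
    refine mul_le_mul (abs_eval_le d Λ P θ) (abs_log_le_of_mem_Icc hε ⟨by linarith, ?_⟩)
      (norm_nonneg _) (Finset.sum_nonneg fun _ _ => norm_nonneg _)
    change ∑ k ∈ Λ, ‖Q k‖ < _ at hQS
    linarith
  · filter_upwards [ae_dm_mem_Td d] with θ hθ
    have h0 := hQ₀.2 θ hθ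
    exact (continuousAt_const.mul (((continuous_eval_coeff d Λ θ).add
      continuous_const).continuousAt.log (add_pos_of_nonneg_of_pos h0 hε).ne')).continuousWithinAt

lemma tendsto_integral_log_add {d : ℕ} {Λ : Finset (Fin d → ℤ)} (hΛ : ∀ k ∈ Λ, -k ∈ Λ)
    (P : (Fin d → ℤ) → ℂ) {Q : (Fin d → ℤ) → ℂ} (hQ : Q ∈ Pbar d Λ) (hQ0 : Q ≠ 0) :
    Tendsto (fun ε => ∫ θ, eval d Λ P θ * Real.log (eval d Λ Q θ + ε) ∂(dm d)) (𝓝[>] 0)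
      (𝓝 (∫ θ, eval d Λ P θ * Real.log (eval d Λ Q θ) ∂(dm d))) := by
  obtain ⟨hne, hint⟩ := ae_eval_ne_zero_and_integrable_log hΛ hQ.1 hQ0
  let S : ((Fin d → ℤ) → ℂ) → ℝ := fun Q => ∑ k ∈ Λ, ‖Q k‖
  refine tendsto_integral_filter_of_dominated_convergence
    (fun θ => S P * (|Real.log (eval d Λ Q θ)| + |Real.log (S Q + 1)|))
    (Eventually.of_forall fun ε => (measurable_eval_mul_log Λ P Q ε).aestronglyMeasurable)
    ?_ ((hint.abs.add (integrable_const _)).const_mul _) ?_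
  · filter_upwards [Ioo_mem_nhdsGT (zero_lt_one' ℝ)] with ε hε
    filter_upwards [ae_dm_mem_Td d, hne] with θ hθ hθ0
    rw [norm_mul]
    have h0 := (hQ.2 θ hθ).lt_of_ne' hθ0
    have h1 : eval d Λ Q θ ≤ S Q := (le_abs_self _).trans (abs_eval_le d Λ Q θ)
    exact mul_le_mul (abs_eval_le d Λ P θ)
      (abs_log_le_of_mem_Icc h0 ⟨by linarith [hε.1], by linarith [hε.2]⟩)
      (norm_nonneg _) (Finset.sum_nonneg fun _ _ => norm_nonneg _)
  · filter_upwards [hne] with θ hθ0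
    have hc : ContinuousAt (fun ε => eval d Λ P θ * Real.log (eval d Λ Q θ + ε)) 0 :=
      continuousAt_const.mul ((continuousAt_const.add continuousAt_id).log
        (by simpa using hθ0))
    have h := hc.tendsto
    rw [add_zero] at h
    exact h.mono_left nhdsWithin_le_nhds

lemma integral_log_le_integral_log_add {d : ℕ} {Λ : Finset (Fin d → ℤ)}
    (hΛ : ∀ k ∈ Λ, -k ∈ Λ) {P Q : (Fin d → ℤ) → ℂ} (hP : P ∈ Pbar d Λ) (hQ : Q ∈ Pbar d Λ)
    (hQ0 : Q ≠ 0) {ε : ℝ} (hε : 0 < ε) :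
    ∫ θ, eval d Λ P θ * Real.log (eval d Λ Q θ) ∂(dm d) ≤
      ∫ θ, eval d Λ P θ * Real.log (eval d Λ Q θ + ε) ∂(dm d) := by
  obtain ⟨hne, hint⟩ := ae_eval_ne_zero_and_integrable_log hΛ hQ.1 hQ0
  refine integral_mono_ae (integrable_eval_mul Λ P hint) (integrable_eval_mul Λ P ?_) ?_
  · refine Integrable.of_bound (Real.measurable_log.comp
      ((continuous_eval d Λ Q).measurable.add_const ε)).aestronglyMeasurable
      (|Real.log ε| + |Real.log ((∑ k ∈ Λ, ‖Q k‖) + ε)|) ?_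
    filter_upwards [ae_dm_mem_Td d] with θ hθ
    have h0 := hQ.2 θ hθ
    have h1 := (le_abs_self _).trans (abs_eval_le d Λ Q θ)
    exact abs_log_le_of_mem_Icc hε ⟨by linarith, by linarith⟩
  · filter_upwards [ae_dm_mem_Td d, hne] with θ hθ hθ0
    exact mul_le_mul_of_nonneg_left
      (Real.log_le_log ((hQ.2 θ hθ).lt_of_ne' hθ0) (by linarith)) (hP.2 θ hθ)

/-- for any P ∈ 𝔓̄₊ \ {0} and c ∈ ℭ₊, the dual functional J_P is lower
semicontinuous on 𝔓̄₊ \ {0} (with the topology of the coefficient space). -/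
theorem statement6 (d : ℕ) (hd : 1 ≤ d) (Λ : Finset (Fin d → ℤ))
    (h0 : (0 : Fin d → ℤ) ∈ Λ) (hΛ : ∀ k ∈ Λ, -k ∈ Λ)
    (c P : (Fin d → ℤ) → ℂ) (hc : c ∈ Cplus d Λ) (hP : P ∈ Pbar d Λ \ {0}) :
    LowerSemicontinuousOn (fun Q => J d Λ c P Q) (Pbar d Λ \ {0}) := by
  intro Q₀ hQ₀ y hy
  let I : ℝ → ((Fin d → ℤ) → ℂ) → ℝ := fun ε Q =>
    ∫ θ, eval d Λ P θ * Real.log (eval d Λ Q θ + ε) ∂(dm d)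
  obtain ⟨ε, hyε, hε⟩ : ∃ ε, y < pair d Λ c Q₀ - I ε Q₀ ∧ 0 < ε :=
    (((tendsto_const_nhds.sub (tendsto_integral_log_add hΛ P hQ₀.1 hQ₀.2)).eventually
      (lt_mem_nhds hy)).and self_mem_nhdsWithin).exists
  have hcont : ContinuousWithinAt (fun Q => pair d Λ c Q - I ε Q) (Pbar d Λ \ {0}) Q₀ :=
    (continuous_pair d Λ c).continuousWithinAt.sub
      ((continuousWithinAt_integral_log_add P Q₀ hQ₀.1 hε).mono sdiff_subset)
  filter_upwards [hcont.eventually (lt_mem_nhds hyε), self_mem_nhdsWithin] with Q hQy hQ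
  exact hQy.trans_le (sub_le_sub_left
    (integral_log_le_integral_log_add hΛ hP.1 hQ.1 hQ.2 hε) _)

end RCE
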